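/- For real r with 0 ≤ r < 1 or r > 1, the global limit of the rescaled pair of characteristic polynomials in the Gaussian complex self-dual ensemble (class AII†) holds: lim_{N→∞} e^{−2N r²} · ∑_{j=0}^{N} [N! (2N−2j)! / ((2N)! (N−j)!)] · (4 N r²)^{j} · E_{2N−2j}(2 N r²) = 1/(1 − r²) if 0 ≤ r < 1, and = 0 if r > 1. -/

import Mathlib

open Filter Finset

/-- The real truncated exponential `E_n(x) = ∑_{j=0}^n x^j/j!`. -/
noncomputable def truncExpR (n : ℕ) (x : ℝ) : ℝ :=
  ∑ j ∈ Finset.range (n + 1), x ^ j / (Nat.factorial j : ℝ)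

lemma truncExpR_nonneg (n : ℕ) {x : ℝ} (hx : 0 ≤ x) : 0 ≤ truncExpR n x :=
  Finset.sum_nonneg fun _ _ => by positivity

lemma truncExpR_succ (n : ℕ) (x : ℝ) :
    truncExpR (n + 1) x = truncExpR n x + x ^ (n + 1) / (Nat.factorial (n + 1) : ℝ) :=
  Finset.sum_range_succ _ _

lemma truncExpR_le_succ (n : ℕ) {x : ℝ} (hx : 0 ≤ x) :
    truncExpR n x ≤ truncExpR (n + 1) x := by
  rw [truncExpR_succ]
  exact le_add_of_nonneg_right (by positivity)

lemma mul_truncExpR_le (n : ℕ) {x : ℝ} (hx : 0 ≤ x) :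
    x * truncExpR n x ≤ (n + 1) * truncExpR (n + 1) x := by
  have h : x * truncExpR n x ≤
      (n + 1) * ∑ j ∈ range (n + 1), x ^ (j + 1) / (Nat.factorial (j + 1) : ℝ) := by
    rw [truncExpR, Finset.mul_sum, Finset.mul_sum]
    refine Finset.sum_le_sum fun j hj => ?_
    have hj' : (j : ℝ) + 1 ≤ n + 1 := by
      exact_mod_cast Finset.mem_range.mp hj
    have e : x * (x ^ j / (Nat.factorial j : ℝ)) =
        (j + 1) * (x ^ (j + 1) / (Nat.factorial (j + 1) : ℝ)) := by
      rw [Nat.factorial_succ]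
      push_cast
      field_simp
      ring
    rw [e]
    gcongr
  refine h.trans ?_
  rw [truncExpR, Finset.sum_range_succ' _ (n + 1)]
  gcongr
  simp

lemma truncExpR_le_exp (n : ℕ) {x : ℝ} (hx : 0 ≤ x) : truncExpR n x ≤ Real.exp x :=
  Real.sum_le_exp_of_nonneg hx _

/-- Chernoff bound for the lower tail of the Poisson distribution. -/
lemma truncExpR_le_of_le_one (n : ℕ) {x s : ℝ} (hx : 0 ≤ x) (hs : 0 ≤ s) (hs1 : s ≤ 1) :
    s ^ n * truncExpR n x ≤ Real.exp (s * x) := by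
  refine le_trans ?_ (truncExpR_le_exp n (mul_nonneg hs hx))
  rw [truncExpR, truncExpR, Finset.mul_sum]
  refine Finset.sum_le_sum fun j hj => ?_
  rw [mul_pow, mul_div_assoc]
  have : s ^ n ≤ s ^ j := pow_le_pow_of_le_one hs hs1 (Nat.lt_succ_iff.mp (mem_range.mp hj))
  gcongr

/-- Chernoff bound for the upper tail of the Poisson distribution. -/
lemma exp_sub_truncExpR_le (n : ℕ) {x s : ℝ} (hx : 0 ≤ x) (hs : 1 ≤ s) :
    s ^ n * (Real.exp x - truncExpR n x) ≤ Real.exp (s * x) := by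
  have hsum (y : ℝ) : HasSum (fun k : ℕ => y ^ k / (Nat.factorial k : ℝ)) (Real.exp y) := by
    rw [Real.exp_eq_exp_ℝ]
    exact NormedSpace.expSeries_div_hasSum_exp y
  have htail := (hasSum_nat_add_iff' (n + 1)).mpr (hsum x)
  have htail' := (hasSum_nat_add_iff' (n + 1)).mpr (hsum (s * x))
  refine (hasSum_le (fun k => ?_) (htail.mul_left (s ^ n)) htail').trans
    (sub_le_self _ (truncExpR_nonneg n (by positivity)))
  rw [mul_pow, mul_div_assoc]
  have : s ^ n ≤ s ^ (k + (n + 1)) := pow_le_pow_right₀ hs (by omega)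
  gcongr

lemma mul_exp_one_sub_lt_one {y : ℝ} (hy : y ≠ 1) : y * Real.exp (1 - y) < 1 := by
  have h : y < Real.exp (y - 1) := by
    have := Real.add_one_lt_exp (sub_ne_zero.mpr hy)
    linarith
  calc y * Real.exp (1 - y) < Real.exp (y - 1) * Real.exp (1 - y) := by gcongr
    _ = 1 := by rw [← Real.exp_add]; simp

/-- The coefficient of `truncExpR (2 * N - 2 * j) x` in the rescaled expectation. -/
noncomputable def selfDualCoeff (N : ℕ) (x : ℝ) (j : ℕ) : ℝ :=
  ((Nat.factorial N : ℝ) * (Nat.factorial (2 * N - 2 * j) : ℝ) /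
    ((Nat.factorial (2 * N) : ℝ) * (Nat.factorial (N - j) : ℝ))) * (2 * x) ^ j

lemma selfDualCoeff_nonneg (N j : ℕ) {x : ℝ} (hx : 0 ≤ x) : 0 ≤ selfDualCoeff N x j := by
  unfold selfDualCoeff
  positivity

lemma selfDualCoeff_zero (N : ℕ) (x : ℝ) : selfDualCoeff N x 0 = 1 := by
  simp only [selfDualCoeff, mul_zero, Nat.sub_zero, pow_zero, mul_one]
  field_simp

lemma selfDualCoeff_succ {N j : ℕ} (x : ℝ) (hj : j < N) :
    selfDualCoeff N x (j + 1) = selfDualCoeff N x j * (x / (2 * N - 2 * j - 1)) := by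
  obtain ⟨k, rfl⟩ := Nat.exists_eq_add_of_lt hj
  have e1 : 2 * (j + k + 1) - 2 * j = 2 * k + 1 + 1 := by omega
  have e2 : 2 * (j + k + 1) - 2 * (j + 1) = 2 * k := by omega
  have e3 : j + k + 1 - j = k + 1 := by omega
  have e4 : j + k + 1 - (j + 1) = k := by omega
  have e5 : 2 * ((j + k + 1 : ℕ) : ℝ) - 2 * j - 1 = 2 * k + 1 := by push_cast; ring
  rw [selfDualCoeff, selfDualCoeff, e1, e2, e3, e4, e5, Nat.factorial_succ (2 * k + 1),
    Nat.factorial_succ (2 * k), Nat.factorial_succ k]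
  push_cast
  field_simp
  ring

lemma selfDualCoeff_mul_truncExpR_succ_le {N j : ℕ} {x : ℝ} (hx : 0 ≤ x) (hj : j < N) :
    selfDualCoeff N x (j + 1) * truncExpR (2 * N - 2 * (j + 1)) x ≤
      selfDualCoeff N x j * truncExpR (2 * N - 2 * j) x := by
  rw [selfDualCoeff_succ x hj, mul_assoc]
  refine mul_le_mul_of_nonneg_left ?_ (selfDualCoeff_nonneg N j hx)
  obtain ⟨k, rfl⟩ := Nat.exists_eq_add_of_lt hj
  have e1 : 2 * (j + k + 1) - 2 * j = 2 * k + 1 + 1 := by omega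
  have e2 : 2 * (j + k + 1) - 2 * (j + 1) = 2 * k := by omega
  have e3 : 2 * ((j + k + 1 : ℕ) : ℝ) - 2 * j - 1 = 2 * k + 1 := by push_cast; ring
  rw [e1, e2, e3, div_mul_eq_mul_div, div_le_iff₀ (by positivity), mul_comm (truncExpR _ _)]
  have h := mul_truncExpR_le (2 * k) hx
  push_cast at h
  exact h.trans (mul_le_mul_of_nonneg_left (truncExpR_le_succ _ hx) (by positivity))

lemma selfDualCoeff_mul_truncExpR_succ_le_mul {N j : ℕ} {x : ℝ} (hx : 0 ≤ x) (hj : j < N) :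
    selfDualCoeff N x (j + 1) * truncExpR (2 * N - 2 * (j + 1)) x ≤
      x / (2 * N - 2 * j - 1) * (selfDualCoeff N x j * truncExpR (2 * N - 2 * j) x) := by
  have hd : (0 : ℝ) ≤ 2 * N - 2 * j - 1 := by
    have : (j : ℝ) + 1 ≤ N := by exact_mod_cast hj
    linarith
  have e : 2 * N - 2 * j = 2 * N - 2 * (j + 1) + 1 + 1 := by omega
  rw [selfDualCoeff_succ x hj, mul_comm (selfDualCoeff N x j) (x / _), mul_assoc, e]
  have h := (truncExpR_le_succ (2 * N - 2 * (j + 1)) hx).trans (truncExpR_le_succ _ hx)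
  have := selfDualCoeff_nonneg N j hx
  gcongr

/-- The `j`-th summand of the rescaled expectation, at `x = 2 N r ^ 2`. -/
noncomputable def selfDualTerm (r : ℝ) (N j : ℕ) : ℝ :=
  Real.exp (-(2 * N * r ^ 2)) *
    (selfDualCoeff N (2 * N * r ^ 2) j * truncExpR (2 * N - 2 * j) (2 * N * r ^ 2))

lemma selfDualTerm_nonneg (r : ℝ) (N j : ℕ) : 0 ≤ selfDualTerm r N j :=
  mul_nonneg (Real.exp_pos _).le
    (mul_nonneg (selfDualCoeff_nonneg N j (by positivity)) (truncExpR_nonneg _ (by positivity)))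

lemma selfDualTerm_zero (r : ℝ) (N : ℕ) :
    selfDualTerm r N 0 =
      Real.exp (-(2 * N * r ^ 2)) * truncExpR (2 * N) (2 * N * r ^ 2) := by
  simp [selfDualTerm, selfDualCoeff_zero]

lemma selfDualTerm_zero_le_one (r : ℝ) (N : ℕ) : selfDualTerm r N 0 ≤ 1 := by
  rw [selfDualTerm_zero, Real.exp_neg, inv_mul_le_iff₀ (Real.exp_pos _), mul_one]
  exact truncExpR_le_exp _ (by positivity)

lemma selfDualTerm_le_of_le (r : ℝ) {N i j : ℕ} (hij : i ≤ j) (hj : j ≤ N) :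
    selfDualTerm r N j ≤ selfDualTerm r N i := by
  induction j, hij using Nat.le_induction with
  | base => exact le_rfl
  | succ j _ ih =>
    exact (mul_le_mul_of_nonneg_left
      (selfDualCoeff_mul_truncExpR_succ_le (by positivity) hj) (Real.exp_pos _).le).trans
        (ih (by omega))

lemma selfDualTerm_le_pow {r q : ℝ} {N j : ℕ} (hq : 0 ≤ q) (hj : j ≤ N)
    (h : ∀ i < j, 2 * N * r ^ 2 / (2 * N - 2 * i - 1) ≤ q) : selfDualTerm r N j ≤ q ^ j := by
  induction j with
  | zero => simpa using selfDualTerm_zero_le_one r N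
  | succ j ih =>
    have h1 : selfDualTerm r N (j + 1) ≤
        2 * N * r ^ 2 / (2 * N - 2 * j - 1) * selfDualTerm r N j := by
      have := mul_le_mul_of_nonneg_left (selfDualCoeff_mul_truncExpR_succ_le_mul
        (x := 2 * N * r ^ 2) (by positivity) hj) (Real.exp_pos (-(2 * N * r ^ 2))).le
      rw [selfDualTerm, selfDualTerm]
      linarith
    rw [pow_succ']
    exact h1.trans (mul_le_mul (h j (by omega)) (ih (by omega) fun i hi => h i (by omega))
      (selfDualTerm_nonneg _ _ _) hq)

/-- Inside the unit disc the summands are dominated by a geometric sequence. -/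
lemma exists_selfDualTerm_le_pow {r : ℝ} (hr : 0 ≤ r) (hr1 : r < 1) :
    ∃ ρ : ℝ, 0 ≤ ρ ∧ ρ < 1 ∧
      ∀ᶠ N : ℕ in atTop, ∀ j ≤ N, selfDualTerm r N j ≤ ρ ^ j := by
  have hr2 : r ^ 2 < 1 := by nlinarith
  obtain ⟨q, hrq, hq1⟩ := exists_between hr2
  have hq0 : 0 < q := (sq_nonneg r).trans_lt hrq
  obtain ⟨K, hK⟩ := exists_nat_gt (2 * q / (q - r ^ 2))
  have hqr : 0 < q - r ^ 2 := sub_pos.mpr hrq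
  have hK0' : (0 : ℝ) < K := lt_trans (by positivity) hK
  have hK0 : 0 < K := by exact_mod_cast hK0'
  rw [div_lt_iff₀ hqr] at hK
  have hρK : (q ^ ((K : ℝ)⁻¹)) ^ K = q := Real.rpow_inv_natCast_pow hq0.le hK0.ne'
  have hρ0 : 0 ≤ q ^ ((K : ℝ)⁻¹) := Real.rpow_nonneg hq0.le _
  have hρ1 : q ^ ((K : ℝ)⁻¹) < 1 := Real.rpow_lt_one hq0.le hq1 (by positivity)
  refine ⟨q ^ ((K : ℝ)⁻¹), hρ0, hρ1, ?_⟩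
  filter_upwards [tendsto_natCast_atTop_atTop.eventually_ge_atTop (q / (q - r ^ 2))] with N hN j hj
  rw [div_le_iff₀ hqr] at hN
  have hKN : N ≤ K * (N / K + 1) := (Nat.lt_mul_div_succ N hK0).le
  calc selfDualTerm r N j ≤ selfDualTerm r N (min j (N / K + 1)) :=
        selfDualTerm_le_of_le r (min_le_left _ _) hj
    _ ≤ q ^ min j (N / K + 1) := by
        refine selfDualTerm_le_pow hq0.le ((min_le_left _ _).trans hj) fun i hi => ?_
        have hiN : i < N := by omega
        have hiN' : (i : ℝ) + 1 ≤ N := by exact_mod_cast hiN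
        have hiK : i * K ≤ N :=
          (Nat.le_div_iff_mul_le hK0).mp (by omega)
        have hiK' : (i : ℝ) * K ≤ N := by exact_mod_cast hiK
        have hiq : 2 * q * i ≤ (q - r ^ 2) * N := by
          nlinarith [mul_le_mul_of_nonneg_left hiK' hqr.le,
            mul_le_mul_of_nonneg_left hK.le (Nat.cast_nonneg (α := ℝ) i)]
        rw [div_le_iff₀ (by linarith)]
        linarith
    _ = (q ^ ((K : ℝ)⁻¹)) ^ (K * min j (N / K + 1)) := by rw [pow_mul, hρK]
    _ ≤ (q ^ ((K : ℝ)⁻¹)) ^ j := by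
        refine pow_le_pow_of_le_one hρ0 hρ1.le ?_
        rcases min_cases j (N / K + 1) with ⟨h, -⟩ | ⟨h, -⟩ <;> rw [h]
        · exact Nat.le_mul_of_pos_left j hK0
        · exact hj.trans hKN

lemma tendsto_selfDualCoeff (r : ℝ) (j : ℕ) :
    Tendsto (fun N : ℕ => selfDualCoeff N (2 * N * r ^ 2) j) atTop (nhds ((r ^ 2) ^ j)) := by
  induction j with
  | zero => simp [selfDualCoeff_zero]
  | succ j ih =>
    have hinv : Tendsto (fun N : ℕ => r ^ 2 / (1 - (j + 1 / 2) / (N : ℝ))) atTop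
        (nhds (r ^ 2 / (1 - 0))) :=
      tendsto_const_nhds.div
        ((tendsto_const_div_atTop_nhds_zero_nat ((j : ℝ) + 1 / 2)).const_sub 1) (by simp)
    rw [sub_zero, div_one] at hinv
    rw [pow_succ]
    refine (ih.mul hinv).congr' ?_
    filter_upwards [eventually_gt_atTop j] with N hN
    rw [selfDualCoeff_succ _ hN]
    congr 1
    have hN' : (j : ℝ) + 1 ≤ N := by exact_mod_cast hN
    have h0 : (N : ℝ) ≠ 0 := by exact_mod_cast (Nat.zero_lt_of_lt hN).ne'
    have h1 : 2 * (N : ℝ) - 2 * j - 1 ≠ 0 := by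
      have : 0 < 2 * (N : ℝ) - 2 * j - 1 := by linarith
      exact this.ne'
    have h2 : 1 - (j + 1 / 2) / (N : ℝ) = (2 * N - 2 * j - 1) / (2 * N) := by
      field_simp
      ring
    rw [h2]
    field_simp

/-- The rate of exponential decay of both Poisson tails. -/
lemma tendsto_mul_exp_pow {r : ℝ} (hr : 0 ≤ r) (hr1 : r ≠ 1) (k : ℕ) :
    Tendsto (fun N : ℕ => (N : ℝ) ^ k * ((r ^ 2 * Real.exp (1 - r ^ 2)) ^ 2) ^ N) atTop
      (nhds 0) := by
  have hy : r ^ 2 ≠ 1 := by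
    intro h
    exact hr1 ((pow_eq_one_iff_of_nonneg hr two_ne_zero).mp h)
  have ha : 0 ≤ r ^ 2 * Real.exp (1 - r ^ 2) := by positivity
  refine tendsto_pow_const_mul_const_pow_of_lt_one k (by positivity) ?_
  exact pow_lt_one₀ ha (mul_exp_one_sub_lt_one hy) two_ne_zero

lemma mul_exp_pow_eq (r : ℝ) (N : ℕ) :
    ((r ^ 2 * Real.exp (1 - r ^ 2)) ^ 2) ^ N =
      (r ^ 2) ^ (2 * N) * (Real.exp (2 * N) * Real.exp (-(2 * N * r ^ 2))) := by
  rw [← pow_mul, mul_pow, ← Real.exp_nat_mul, ← Real.exp_add]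
  push_cast
  ring_nf

lemma tendsto_exp_mul_truncExpR {r : ℝ} (hr : 0 ≤ r) (hr1 : r < 1) (j : ℕ) :
    Tendsto (fun N : ℕ => Real.exp (-(2 * N * r ^ 2)) *
      truncExpR (2 * N - 2 * j) (2 * N * r ^ 2)) atTop (nhds 1) := by
  rcases hr.eq_or_lt with rfl | hr0
  · simp [truncExpR, Finset.sum_range_succ']
  have h := (tendsto_mul_exp_pow hr hr1.ne 0).mul_const (((r ^ 2) ^ (2 * j))⁻¹)
  have h' := h.const_sub 1
  simp only [pow_zero, one_mul, zero_mul, sub_zero] at h'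
  refine tendsto_of_tendsto_of_tendsto_of_le_of_le' h' tendsto_const_nhds ?_ ?_
  · filter_upwards [eventually_ge_atTop j] with N hN
    have hs : 1 ≤ (r ^ 2)⁻¹ := (one_le_inv₀ (by positivity)).mpr (by nlinarith)
    have hc := exp_sub_truncExpR_le (2 * N - 2 * j) (x := 2 * N * r ^ 2) (by positivity) hs
    have e : (r ^ 2)⁻¹ * (2 * N * r ^ 2) = 2 * N := by field_simp
    rw [e, inv_pow, inv_mul_le_iff₀ (by positivity)] at hc
    have hp : (r ^ 2) ^ (2 * N) * ((r ^ 2) ^ (2 * j))⁻¹ = (r ^ 2) ^ (2 * N - 2 * j) :=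
      (pow_sub₀ _ (by positivity) (by omega)).symm
    have hm := mul_le_mul_of_nonneg_left hc (Real.exp_pos (-(2 * N * r ^ 2))).le
    have he : Real.exp (-(2 * N * r ^ 2)) * Real.exp (2 * N * r ^ 2) = 1 := by
      rw [← Real.exp_add]; simp
    rw [mul_sub, he, ← hp] at hm
    rw [mul_exp_pow_eq]
    linarith
  · refine Eventually.of_forall fun N => ?_
    rw [Real.exp_neg, inv_mul_le_iff₀ (Real.exp_pos _), mul_one]
    exact truncExpR_le_exp _ (by positivity)

lemma tendsto_selfDualTerm {r : ℝ} (hr : 0 ≤ r) (hr1 : r < 1) (j : ℕ) :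
    Tendsto (fun N : ℕ => selfDualTerm r N j) atTop (nhds ((r ^ 2) ^ j)) := by
  have h := (tendsto_selfDualCoeff r j).mul (tendsto_exp_mul_truncExpR hr hr1 j)
  rw [mul_one] at h
  refine h.congr fun N => ?_
  rw [selfDualTerm]
  ring

lemma tendsto_sum_selfDualTerm_of_lt_one {r : ℝ} (hr : 0 ≤ r) (hr1 : r < 1) :
    Tendsto (fun N : ℕ => ∑ j ∈ range (N + 1), selfDualTerm r N j) atTop
      (nhds (1 / (1 - r ^ 2))) := by
  obtain ⟨ρ, hρ0, hρ1, hρ⟩ := exists_selfDualTerm_le_pow hr hr1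
  rw [one_div, ← tsum_geometric_of_lt_one (sq_nonneg r) (by nlinarith)]
  have key : Tendsto (fun N : ℕ => ∑' j, if j ∈ range (N + 1) then selfDualTerm r N j else 0)
      atTop (nhds (∑' j : ℕ, (r ^ 2) ^ j)) := by
    refine tendsto_tsum_of_dominated_convergence (summable_geometric_of_lt_one hρ0 hρ1)
      (fun j => ?_) ?_
    · refine (tendsto_selfDualTerm hr hr1 j).congr' ?_
      filter_upwards [eventually_ge_atTop j] with N hN
      rw [if_pos (mem_range.mpr (by omega))]
    · filter_upwards [hρ] with N hN j
      split_ifs with hj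
      · rw [Real.norm_of_nonneg (selfDualTerm_nonneg _ _ _)]
        exact hN j (Nat.lt_succ_iff.mp (mem_range.mp hj))
      · rw [norm_zero]
        positivity
  refine key.congr fun N => ?_
  rw [tsum_eq_sum (s := range (N + 1)) fun j hj => if_neg hj]
  exact Finset.sum_congr rfl fun j hj => if_pos hj

lemma tendsto_sum_selfDualTerm_of_one_lt {r : ℝ} (hr1 : 1 < r) :
    Tendsto (fun N : ℕ => ∑ j ∈ range (N + 1), selfDualTerm r N j) atTop (nhds 0) := by
  have hr : 0 < r := by linarith
  have h := (tendsto_mul_exp_pow hr.le hr1.ne' 1).add (tendsto_mul_exp_pow hr.le hr1.ne' 0)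
  rw [add_zero] at h
  refine squeeze_zero (fun N => Finset.sum_nonneg fun j _ => selfDualTerm_nonneg r N j)
    (fun N => ?_) h
  have h0 : selfDualTerm r N 0 ≤ ((r ^ 2 * Real.exp (1 - r ^ 2)) ^ 2) ^ N := by
    have hs : (r ^ 2)⁻¹ ≤ 1 := inv_le_one_of_one_le₀ (by nlinarith)
    have hc := truncExpR_le_of_le_one (2 * N) (x := 2 * N * r ^ 2) (by positivity)
      (by positivity) hs
    have e : (r ^ 2)⁻¹ * (2 * N * r ^ 2) = 2 * N := by field_simp
    rw [e, inv_pow, inv_mul_le_iff₀ (by positivity)] at hc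
    rw [selfDualTerm_zero, mul_exp_pow_eq]
    have := mul_le_mul_of_nonneg_left hc (Real.exp_pos (-(2 * N * r ^ 2))).le
    linarith
  calc ∑ j ∈ range (N + 1), selfDualTerm r N j
      ≤ ∑ _j ∈ range (N + 1), selfDualTerm r N 0 := Finset.sum_le_sum fun j hj =>
        selfDualTerm_le_of_le r (Nat.zero_le j) (Nat.lt_succ_iff.mp (mem_range.mp hj))
    _ = (N + 1) * selfDualTerm r N 0 := by simp
    _ ≤ (N + 1) * ((r ^ 2 * Real.exp (1 - r ^ 2)) ^ 2) ^ N := by gcongr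
    _ = _ := by ring

/-- Global limit for class AII† (complex self-dual): for `0 ≤ r < 1` or `r > 1`, the
rescaled expectation converges to `1/(1 − r²)` for `r < 1` and to `0` for `r > 1`. -/
theorem statement7 (r : ℝ) (hr : 0 ≤ r) (hr1 : r ≠ 1) :
    Tendsto (fun N : ℕ => Real.exp (-(2 * N * r ^ 2)) *
        ∑ j ∈ Finset.range (N + 1),
          ((Nat.factorial N : ℝ) * (Nat.factorial (2 * N - 2 * j) : ℝ) /
              ((Nat.factorial (2 * N) : ℝ) * (Nat.factorial (N - j) : ℝ))) *
            (4 * N * r ^ 2) ^ j * truncExpR (2 * N - 2 * j) (2 * N * r ^ 2))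
      atTop (nhds (if r < 1 then 1 / (1 - r ^ 2) else 0)) := by
  have e (N : ℕ) : Real.exp (-(2 * N * r ^ 2)) *
        ∑ j ∈ Finset.range (N + 1),
          ((Nat.factorial N : ℝ) * (Nat.factorial (2 * N - 2 * j) : ℝ) /
              ((Nat.factorial (2 * N) : ℝ) * (Nat.factorial (N - j) : ℝ))) *
            (4 * N * r ^ 2) ^ j * truncExpR (2 * N - 2 * j) (2 * N * r ^ 2) =
      ∑ j ∈ range (N + 1), selfDualTerm r N j := by
    rw [Finset.mul_sum]
    refine Finset.sum_congr rfl fun j _ => ?_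
    rw [selfDualTerm, selfDualCoeff, show 2 * (2 * (N : ℝ) * r ^ 2) = 4 * N * r ^ 2 by ring]
  simp only [e]
  split_ifs with h
  · exact tendsto_sum_selfDualTerm_of_lt_one hr h
  · exact tendsto_sum_selfDualTerm_of_one_lt (lt_of_le_of_ne (not_lt.mp h) hr1.symm)
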